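/- Let n ≥ 3 be an integer, p ∈ (1, n/2) and −n(p−1) < β < n − 2p. Then for every f ∈ C_c^∞(ℝ^n), ∫_{ℝ^n} |Δ_r f(x)|^p / |x|^β dx ≥ ( (n(p−1)+β)(n−2p−β) / p² )^p ∫_{ℝ^n} |f(x)|^p / |x|^{2p+β} dx. -/

import Mathlib

open MeasureTheory

/-- The radial derivative `∂_r f (x) = ⟨x/|x|, ∇f(x)⟩` of `f : ℝⁿ → ℝ`. -/
noncomputable def radDeriv {n : ℕ} (f : EuclideanSpace ℝ (Fin n) → ℝ)
    (x : EuclideanSpace ℝ (Fin n)) : ℝ :=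
  fderiv ℝ f x (‖x‖⁻¹ • x)

/-- The radial Laplacian `Δ_r f = ∂_r² f + ((n-1)/|x|) ∂_r f`. -/
noncomputable def radLap {n : ℕ} (f : EuclideanSpace ℝ (Fin n) → ℝ)
    (x : EuclideanSpace ℝ (Fin n)) : ℝ :=
  radDeriv (radDeriv f) x + ((n : ℝ) - 1) / ‖x‖ * radDeriv f x

open Set Filter Topology in
lemma integ_aux {g : ℝ → ℝ} (hg : Measurable g) {K q R : ℝ} (hq : -1 < q) (hR : 0 < R)
    (h1 : ∀ r, 0 < r → r < R → |g r| ≤ K * r ^ q) (h2 : ∀ r, R ≤ r → g r = 0) :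
    IntegrableOn g (Ioi 0) := by
  have h3 : IntegrableOn g (Ioo 0 R) := by
    have := ((intervalIntegral.integrableOn_Ioo_rpow_iff hR).2 hq).const_mul K
    refine Integrable.mono' this hg.aestronglyMeasurable ?_
    refine (ae_restrict_iff' measurableSet_Ioo).2 (Eventually.of_forall fun r hr => ?_)
    exact h1 r hr.1 hr.2
  have h4 : IntegrableOn g (Ici R) :=
    (integrableOn_zero : IntegrableOn (fun _ : ℝ => (0 : ℝ)) (Ici R)).congr_fun
      (fun r hr => (h2 r hr).symm) measurableSet_Ici
  rw [← Ioo_union_Ici_eq_Ioi hR]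
  exact h3.union h4

lemma young_aux {p a l : ℝ} (hp : 1 < p) (ha : 0 ≤ a) (hl : 0 ≤ l) :
    p * (a ^ (p - 1) * l) ≤ (p - 1) * a ^ p + l ^ p := by
  have hc := Real.HolderConjugate.conjExponent hp
  have := Real.young_inequality_of_nonneg hl (Real.rpow_nonneg ha (p - 1)) hc
  have h0 : p - 1 ≠ 0 := by linarith
  have h0' : 0 < p := by linarith
  rw [← Real.rpow_mul ha] at this
  unfold Real.conjExponent at this
  have e : (p - 1) * (p / (p - 1)) = p := by field_simp
  rw [e] at this
  have h2 := mul_le_mul_of_nonneg_left this h0'.le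
  have e2 : p * (l ^ p / p + a ^ p / (p / (p - 1))) = (p - 1) * a ^ p + l ^ p := by
    field_simp; ring
  rw [e2] at h2
  linarith

lemma pointwise_aux {p b k s ε : ℝ} (hp : 1 < p) (hs : 0 ≤ s) (hε : |ε| = 1)
    (hA : ε * (b + 1 - p - k * p) = p * s) (u v r : ℝ) (hr : 0 < r) :
    s ^ p * (|u| ^ p * r ^ (b - p)) + (- (ε * s ^ (p - 1)) *
      (p * |u| ^ (p - 2) * u * v * r ^ (b + 1 - p) + |u| ^ p * ((b + 1 - p) * r ^ (b - p))))
      ≤ |v + k / r * u| ^ p * r ^ b := by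
  set L := v + k / r * u with hL
  have hv : v = L - k / r * u := by rw [hL]; ring
  set w := |u| ^ (p - 2) * u * r ^ (b + 1 - p) with hw
  set a := |u| / r with ha
  have ha0 : 0 ≤ a := by positivity
  have hsp : s ^ (p - 1) * s = s ^ p := by
    rw [← Real.rpow_add_one' hs (by linarith)]; ring_nf
  have huu : |u| ^ (p - 2) * u * u = |u| ^ p := by
    rw [mul_assoc, ← abs_mul_abs_self u, ← mul_assoc,
      ← Real.rpow_add_one' (abs_nonneg u) (by linarith),
      ← Real.rpow_add_one' (abs_nonneg u) (by linarith)]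
    ring_nf
  have hua : |u| ^ (p - 2) * |u| = |u| ^ (p - 1) := by
    rw [← Real.rpow_add_one' (abs_nonneg u) (by linarith)]; ring_nf
  have hrr : r ^ (b + 1 - p) = r ^ (b - p) * r := by
    rw [← Real.rpow_add_one hr.ne']; ring_nf
  have hap : |u| ^ p * r ^ (b - p) = a ^ p * r ^ b := by
    rw [ha, Real.div_rpow (abs_nonneg u) hr.le, Real.rpow_sub hr]; field_simp
  have haw : |w| = a ^ (p - 1) * r ^ b := by
    rw [hw, abs_mul, abs_mul, abs_of_nonneg (Real.rpow_nonneg (abs_nonneg u) _),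
      abs_of_nonneg (Real.rpow_nonneg hr.le _), hua, ha, Real.div_rpow (abs_nonneg u) hr.le,
      show b + 1 - p = b - (p - 1) by ring, Real.rpow_sub hr]; field_simp
  have hG : p * |u| ^ (p - 2) * u * v * r ^ (b + 1 - p) + |u| ^ p * ((b + 1 - p) * r ^ (b - p))
      = p * (w * L) + (b + 1 - p - k * p) * (a ^ p * r ^ b) := by
    rw [← hap, hv, hw, hrr, ← huu]; field_simp; ring
  rw [hG, hap]
  have hwl : -(ε * (w * L)) ≤ a ^ (p - 1) * r ^ b * |L| := by
    rw [← haw]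
    calc _ ≤ |ε * (w * L)| := neg_le_abs _
      _ = _ := by rw [abs_mul, abs_mul, hε, one_mul]
  have hy := young_aux hp (mul_nonneg hs ha0) (abs_nonneg L)
  rw [Real.mul_rpow hs ha0, Real.mul_rpow hs ha0] at hy
  have hy2 := mul_le_mul_of_nonneg_right hy (Real.rpow_nonneg hr.le b)
  have hs1 : 0 ≤ p * s ^ (p - 1) := by positivity
  have hw2 := mul_le_mul_of_nonneg_left hwl hs1
  have e : - (ε * s ^ (p - 1)) * (p * (w * L) + (b + 1 - p - k * p) * (a ^ p * r ^ b))
    = p * s ^ (p - 1) * (-(ε * (w * L))) - p * s ^ p * (a ^ p * r ^ b) := by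
    rw [← hsp]
    linear_combination (- s ^ (p - 1) * (a ^ p * r ^ b)) * hA
  rw [e]
  nlinarith [hw2, hy2]

open Set Filter Topology in
lemma hardy_aux {p b k s : ℝ} (hp : 1 < p) (hb : 0 < b + 1 - p)
    (hs : s = |b + 1 - p - k * p| / p) {u : ℝ → ℝ} (hu : ContDiff ℝ 1 u)
    (huc : HasCompactSupport u) :
    s ^ p * ∫ r in Ioi (0:ℝ), |u r| ^ p * r ^ (b - p) ≤
      ∫ r in Ioi (0:ℝ), |deriv u r + k / r * u r| ^ p * r ^ b := by
  have hp0 : 0 < p := by linarith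
  have hs0 : 0 ≤ s := by rw [hs]; positivity
  obtain ⟨ε, hε, hA⟩ : ∃ ε : ℝ, |ε| = 1 ∧ ε * (b + 1 - p - k * p) = p * s := by
    have : p * s = |b + 1 - p - k * p| := by rw [hs]; field_simp
    rw [this]
    rcases le_total 0 (b + 1 - p - k * p) with h | h
    · exact ⟨1, by simp, by rw [abs_of_nonneg h]; ring⟩
    · exact ⟨-1, by simp, by rw [abs_of_nonpos h]; ring⟩
  have hdc : Continuous (deriv u) := hu.continuous_deriv le_rfl
  obtain ⟨M, hM⟩ := huc.exists_bound_of_continuous hu.continuous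
  obtain ⟨M', hM'⟩ := huc.deriv.exists_bound_of_continuous hdc
  have hM0 : 0 ≤ M := (norm_nonneg _).trans (hM 0)
  have hM0' : 0 ≤ M' := (norm_nonneg _).trans (hM' 0)
  simp only [Real.norm_eq_abs] at hM hM'
  obtain ⟨R, hR, hRs⟩ : ∃ R : ℝ, 0 < R ∧ ∀ r, R ≤ r → r ∉ tsupport u := by
    obtain ⟨R, hR⟩ := huc.isCompact.isBounded.subset_ball 0
    refine ⟨max R 1, by positivity, fun r hr h => ?_⟩
    have := hR h
    simp only [Metric.mem_ball, dist_zero_right, Real.norm_eq_abs] at this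
    have := le_abs_self r
    have := le_max_left R 1
    linarith
  have hu0 : ∀ r, R ≤ r → u r = 0 := fun r hr => image_eq_zero_of_notMem_tsupport (hRs r hr)
  have hd0 : ∀ r, R ≤ r → deriv u r = 0 := fun r hr => by
    by_contra h
    exact hRs r hr (support_deriv_subset h)
  have hum : Measurable u := hu.continuous.measurable
  have hdm : Measurable (deriv u) := hdc.measurable
  have I1 : IntegrableOn (fun r => |u r| ^ p * r ^ (b - p)) (Ioi 0) := by
    refine integ_aux (K := M ^ p) (q := b - p) (R := R) (by fun_prop) (by linarith) hR ?_ ?_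
    · intro r h0 _
      rw [abs_of_nonneg (by positivity)]
      gcongr
      exact hM r
    · intro r hr
      simp [hu0 r hr, hp0.ne']
  have I2 : IntegrableOn (fun r => |deriv u r + k / r * u r| ^ p * r ^ b) (Ioi 0) := by
    refine integ_aux (K := (M' * R + |k| * M) ^ p) (q := b - p) (R := R) (by fun_prop)
      (by linarith) hR ?_ ?_
    · intro r h0 h1
      rw [abs_of_nonneg (by positivity), Real.rpow_sub h0]
      have : |deriv u r + k / r * u r| ≤ (M' * R + |k| * M) / r := by
        rw [le_div_iff₀ h0, ← abs_of_pos h0, ← abs_mul, abs_of_pos h0]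
        have : (deriv u r + k / r * u r) * r = deriv u r * r + k * u r := by field_simp
        rw [this]
        refine (abs_add_le _ _).trans ?_
        rw [abs_mul, abs_mul, abs_of_pos h0]
        gcongr
        · exact hM' r
        · exact hM r
      calc _ ≤ ((M' * R + |k| * M) / r) ^ p * r ^ b := by gcongr
        _ = _ := by rw [Real.div_rpow (by positivity) h0.le]; ring
    · intro r hr
      simp [hu0 r hr, hd0 r hr, hp0.ne']
  set G : ℝ → ℝ := fun r => |u r| ^ p * r ^ (b + 1 - p) with hG
  set G' : ℝ → ℝ := fun r => p * |u r| ^ (p - 2) * u r * deriv u r * r ^ (b + 1 - p)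
    + |u r| ^ p * ((b + 1 - p) * r ^ (b - p)) with hG'
  have I3 : IntegrableOn G' (Ioi 0) := by
    refine Integrable.add ?_ ?_
    · refine integ_aux (K := p * M ^ (p - 1) * M') (q := b + 1 - p) (R := R) (by fun_prop)
        (by linarith) hR ?_ ?_
      · intro r h0 _
        have hua : |u r| ^ (p - 2) * |u r| = |u r| ^ (p - 1) := by
          rw [← Real.rpow_add_one' (abs_nonneg _) (by linarith)]; ring_nf
        rw [abs_mul, abs_mul, abs_mul, abs_mul, abs_of_pos hp0,
          abs_of_nonneg (Real.rpow_nonneg (abs_nonneg _) _),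
          abs_of_nonneg (Real.rpow_nonneg h0.le _), mul_assoc p, hua]
        have := hM r
        have := hM' r
        have : 0 ≤ p - 1 := by linarith
        gcongr
      · intro r hr
        simp [hu0 r hr]
    · have := I1.const_mul (b + 1 - p)
      refine this.congr (Eventually.of_forall fun r => ?_)
      ring
  have F : ∫ r in Ioi (0:ℝ), G' r = 0 := by
    have := integral_Ioi_of_hasDerivAt_of_tendsto (f := G) (f' := G') (a := 0) (m := 0) ?_ ?_ I3 ?_
    · rw [this]; simp [hG, Real.zero_rpow hb.ne']
    · apply Continuous.continuousWithinAt
      have := hu.continuous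
      refine Continuous.mul ?_ ?_
      · exact (this.abs).rpow_const fun _ => Or.inr hp0.le
      · exact continuous_id.rpow_const fun _ => Or.inr hb.le
    · intro r hr
      have h1 := (hasDerivAt_abs_rpow (u r) hp).comp r
        (hu.differentiable one_ne_zero r).hasDerivAt
      have h2 := Real.hasDerivAt_rpow_const (x := r) (p := b + 1 - p) (Or.inl (ne_of_gt hr))
      rw [show b + 1 - p - 1 = b - p by ring] at h2
      exact h1.mul h2
    · refine tendsto_const_nhds.congr' ?_
      filter_upwards [eventually_ge_atTop R] with r hr
      simp [hG, hu0 r hr, hp0.ne']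
  have key : ∫ r in Ioi (0:ℝ), (s ^ p * (|u r| ^ p * r ^ (b - p)) + (- (ε * s ^ (p - 1)) * G' r))
      ≤ ∫ r in Ioi (0:ℝ), |deriv u r + k / r * u r| ^ p * r ^ b := by
    refine setIntegral_mono_on ((I1.const_mul _).add (I3.const_mul _)) I2 measurableSet_Ioi ?_
    intro r hr
    exact pointwise_aux hp hs0 hε hA (u r) (deriv u r) r hr
  rw [integral_add (I1.const_mul _) (I3.const_mul _), integral_const_mul, integral_const_mul, F]
    at key
  simpa using key

open Set in
lemma polar_aux {E : Type*} [NormedAddCommGroup E] [NormedSpace ℝ E] [MeasurableSpace E]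
    [BorelSpace E] [FiniteDimensional ℝ E] [Nontrivial E] (μ : Measure E) [μ.IsAddHaarMeasure]
    {n : ℕ} (hd : Module.finrank ℝ E = n) {F : E → ℝ} (hF : Integrable F μ) :
    Integrable (fun θ : Metric.sphere (0 : E) 1 =>
      ∫ r in Ioi (0:ℝ), r ^ (n - 1) * F (r • θ.1))
      μ.toSphere ∧
    ∫ x, F x ∂μ = ∫ θ, (∫ r in Ioi (0:ℝ), r ^ (n - 1) * F (r • θ.1))
      ∂(μ.toSphere) := by
  have hmp := μ.measurePreserving_homeomorphUnitSphereProd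
  rw [hd] at hmp
  have hemb := (Homeomorph.measurableEmbedding (homeomorphUnitSphereProd E))
  set H : Metric.sphere (0:E) 1 × Ioi (0:ℝ) → ℝ := fun z => F (z.2.1 • z.1.1) with hH
  have hcomp : ∀ x : ({0}ᶜ : Set E), H (homeomorphUnitSphereProd E x) = F x := by
    intro x
    have hx : ‖x.1‖ ≠ 0 := norm_ne_zero_iff.2 x.2
    simp [hH, smul_smul, hx]
  have hI : Integrable H (μ.toSphere.prod (.volumeIoiPow (n - 1))) := by
    rw [← hmp.integrable_comp_emb hemb]
    have h1 : Integrable (fun x : ({0}ᶜ : Set E) => F x) (μ.comap (↑)) := by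
      have := (integrableOn_iff_comap_subtypeVal (μ := μ) (f := F)
        (measurableSet_singleton (0:E)).compl).1 hF.integrableOn
      exact this
    refine h1.congr (Filter.Eventually.of_forall fun x => (hcomp x).symm)
  have hinner : ∀ θ : Metric.sphere (0:E) 1, ∫ r, H (θ, r) ∂(Measure.volumeIoiPow (n - 1))
      = ∫ r in Ioi (0:ℝ), r ^ (n - 1) * F (r • θ.1) := by
    intro θ
    simp only [Measure.volumeIoiPow, ENNReal.ofReal, hH]
    rw [integral_withDensity_eq_integral_smul,
        integral_subtype_comap measurableSet_Ioi
          fun a ↦ Real.toNNReal (a ^ (n - 1)) • F (a • θ.1),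
        setIntegral_congr_fun measurableSet_Ioi fun x hx ↦ ?_]
    · rw [NNReal.smul_def, Real.coe_toNNReal _ (pow_nonneg hx.out.le _), smul_eq_mul]
    · exact (measurable_subtype_coe.pow_const _).real_toNNReal
  constructor
  · refine hI.integral_prod_left.congr (Filter.Eventually.of_forall fun θ => hinner θ)
  · calc ∫ x, F x ∂μ = ∫ x : ({(0)}ᶜ : Set E), F x ∂(μ.comap (↑)) := by
          rw [integral_subtype_comap (measurableSet_singleton _).compl fun x ↦ F x,
            restrict_compl_singleton]
      _ = ∫ x, H (homeomorphUnitSphereProd E x) ∂(μ.comap (↑)) := by simp only [hcomp]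
      _ = ∫ z, H z ∂(μ.toSphere.prod (.volumeIoiPow (n - 1))) := hmp.integral_comp hemb H
      _ = _ := by
        rw [integral_prod _ hI]
        simp only [hinner]

lemma integE_aux {E : Type*} [NormedAddCommGroup E] [NormedSpace ℝ E] [MeasurableSpace E]
    [BorelSpace E] [FiniteDimensional ℝ E] [Nontrivial E] (μ : Measure E) [μ.IsAddHaarMeasure]
    {n : ℕ} (hn : 1 ≤ n) (hd : Module.finrank ℝ E = n) {F : E → ℝ} (hF : Measurable F)
    {K q R : ℝ} (hq : -(n : ℝ) < q) (hR : 0 < R)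
    (h1 : ∀ x, x ≠ 0 → ‖x‖ < R → |F x| ≤ K * ‖x‖ ^ q) (h2 : ∀ x, R ≤ ‖x‖ → F x = 0) :
    Integrable F μ := by
  set g : ℝ → ℝ := (Set.Iio R).indicator fun r => K * r ^ q with hg
  have hgm : Measurable g := Measurable.indicator (by fun_prop) measurableSet_Iio
  have hgi : Integrable (fun x : E => g ‖x‖) μ := by
    rw [integrable_fun_norm_addHaar, hd]
    refine integ_aux (K := |K|) (q := n - 1 + q) (R := R) ?_ (by linarith) hR ?_ ?_
    · exact (measurable_id.pow_const _).smul hgm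
    · intro r h0 hr
      simp only [hg, Set.indicator, Set.mem_Iio, hr, if_true, smul_eq_mul]
      rw [abs_mul, abs_mul, abs_of_pos (Real.rpow_pos_of_pos h0 _), abs_of_pos (pow_pos h0 _),
        Real.rpow_add h0, ← Real.rpow_natCast, Nat.cast_sub hn, Nat.cast_one]
      apply le_of_eq; ring
    · intro r hr
      simp [hg, Set.indicator, not_lt.2 hr]
  refine hgi.mono' hF.aestronglyMeasurable ?_
  have : ∀ᵐ x ∂μ, x ≠ 0 := by simp [ae_iff]
  filter_upwards [this] with x hx
  by_cases hxR : ‖x‖ < R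
  · simpa [hg, Set.indicator, hxR] using h1 x hx hxR
  · simp [hg, Set.indicator, hxR, h2 x (not_lt.1 hxR)]

lemma radDeriv_ray {n : ℕ} {g : EuclideanSpace ℝ (Fin n) → ℝ} {θ : EuclideanSpace ℝ (Fin n)}
    (hθ : ‖θ‖ = 1) {r : ℝ} (hr : 0 < r) (hg : DifferentiableAt ℝ g (r • θ)) :
    radDeriv g (r • θ) = deriv (fun t : ℝ => g (t • θ)) r := by
  have h1 : HasDerivAt (fun t : ℝ => t • θ) θ r := by
    simpa using (hasDerivAt_id r).smul_const θ
  have h2 := hg.hasFDerivAt.comp_hasDerivAt r h1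
  have h3 : deriv (fun t : ℝ => g (t • θ)) r = fderiv ℝ g (r • θ) θ := h2.deriv
  rw [h3, radDeriv, norm_smul, hθ, Real.norm_eq_abs, abs_of_pos hr, smul_smul]
  simp [hr.ne']

lemma measurable_radDeriv {n : ℕ} (g : EuclideanSpace ℝ (Fin n) → ℝ) :
    Measurable (radDeriv g) := by
  have h1 : Measurable (fun x => (fderiv ℝ g x, ‖x‖⁻¹ • x)) :=
    (measurable_fderiv ℝ g).prodMk (measurable_norm.inv.smul measurable_id)
  have h2 : Continuous (fun z : (EuclideanSpace ℝ (Fin n) →L[ℝ] ℝ) × EuclideanSpace ℝ (Fin n) =>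
    z.1 z.2) := isBoundedBilinearMap_apply.continuous
  exact h2.measurable.comp h1

lemma measurable_radLap {n : ℕ} (g : EuclideanSpace ℝ (Fin n) → ℝ) :
    Measurable (radLap g) := by
  have := measurable_radDeriv g
  have := measurable_radDeriv (radDeriv g)
  unfold radLap
  fun_prop

lemma differentiableAt_radDeriv {n : ℕ} {f : EuclideanSpace ℝ (Fin n) → ℝ}
    (hf : ContDiff ℝ (⊤ : ℕ∞) f) {x : EuclideanSpace ℝ (Fin n)} (hx : x ≠ 0) :
    DifferentiableAt ℝ (radDeriv f) x := by
  have h1 : DifferentiableAt ℝ (fderiv ℝ f) x :=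
    (hf.fderiv_right (m := 1) (by norm_cast)).differentiable one_ne_zero x
  have h2 : DifferentiableAt ℝ (fun x : EuclideanSpace ℝ (Fin n) => ‖x‖⁻¹ • x) x :=
    ((differentiableAt_id.norm ℝ hx).inv (norm_ne_zero_iff.2 hx)).smul differentiableAt_id
  exact h1.clm_apply h2

lemma radLap_ray {n : ℕ} {f : EuclideanSpace ℝ (Fin n) → ℝ}
    (hf : ContDiff ℝ (⊤ : ℕ∞) f) {θ : EuclideanSpace ℝ (Fin n)}
    (hθ : ‖θ‖ = 1) {r : ℝ} (hr : 0 < r) :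
    radLap f (r • θ) = deriv (deriv (fun t : ℝ => f (t • θ))) r
      + ((n : ℝ) - 1) / r * deriv (fun t : ℝ => f (t • θ)) r := by
  have hθ0 : θ ≠ 0 := by rintro rfl; simp at hθ
  have hd : Differentiable ℝ f := hf.differentiable (by simp)
  rw [radLap, radDeriv_ray hθ hr (hd _),
    radDeriv_ray hθ hr (differentiableAt_radDeriv hf (smul_ne_zero hr.ne' hθ0)),
    norm_smul, hθ, Real.norm_eq_abs, abs_of_pos hr, mul_one]
  congr 1
  apply Filter.EventuallyEq.deriv_eq
  filter_upwards [lt_mem_nhds hr] with t ht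
  exact radDeriv_ray hθ ht (hd _)

lemma ray_deriv1 {E : Type*} [NormedAddCommGroup E] [NormedSpace ℝ E] {F : Type*}
    [NormedAddCommGroup F] [NormedSpace ℝ F] {f : E → F} (hd : Differentiable ℝ f) (θ : E) (r : ℝ) :
    HasDerivAt (fun t : ℝ => f (t • θ)) (fderiv ℝ f (r • θ) θ) r := by
  have hl : HasDerivAt (fun t : ℝ => t • θ) θ r := by
    simpa using (hasDerivAt_id r).smul_const θ
  exact (hd _).hasFDerivAt.comp_hasDerivAt r hl

lemma ray_deriv2 {E : Type*} [NormedAddCommGroup E] [NormedSpace ℝ E]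
    {f : E → ℝ} (hd : Differentiable ℝ f) (hd2 : Differentiable ℝ (fderiv ℝ f)) (θ : E) (r : ℝ) :
    deriv (deriv (fun t : ℝ => f (t • θ))) r = fderiv ℝ (fderiv ℝ f) (r • θ) θ θ := by
  have e1 : deriv (fun t : ℝ => f (t • θ)) = fun t => fderiv ℝ f (t • θ) θ := by
    funext t
    exact (ray_deriv1 hd θ t).deriv
  rw [e1]
  have h3 := ray_deriv1 hd2 θ r
  exact ((ContinuousLinearMap.apply ℝ ℝ θ).hasFDerivAt.comp_hasDerivAt r h3).deriv

lemma bound_aux {E F : Type*} [NormedAddCommGroup E] [NormedAddCommGroup F] {g : E → F}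
    (hg : Continuous g) (hc : HasCompactSupport g) : ∃ M : ℝ, 0 ≤ M ∧ ∀ x, ‖g x‖ ≤ M := by
  obtain ⟨M, hM⟩ := hc.exists_bound_of_continuous hg
  exact ⟨M, (norm_nonneg _).trans (hM 0), hM⟩

lemma bound_fderiv_aux {E F : Type*} [NormedAddCommGroup E] [NormedSpace ℝ E]
    [NormedAddCommGroup F] [NormedSpace ℝ F] {g : E → F}
    (hg : ContDiff ℝ 1 g) (hc : HasCompactSupport g) :
    ∃ M : ℝ, 0 ≤ M ∧ ∀ x v, ‖fderiv ℝ g x v‖ ≤ M * ‖v‖ := by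
  obtain ⟨M, h0, hM⟩ := bound_aux (hg.continuous_fderiv one_ne_zero) (hc.fderiv ℝ)
  exact ⟨M, h0, fun x v => (ContinuousLinearMap.le_opNorm _ _).trans
    (mul_le_mul_of_nonneg_right (hM x) (norm_nonneg v))⟩

lemma bounds_ray {E : Type*} [NormedAddCommGroup E] [NormedSpace ℝ E] {f : E → ℝ}
    (hf : ContDiff ℝ (⊤ : ℕ∞) f) (hfc : HasCompactSupport f) :
    ∃ M1 M2 : ℝ, 0 ≤ M1 ∧ 0 ≤ M2 ∧ ∀ θ : E, ‖θ‖ = 1 → ∀ r : ℝ,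
      |deriv (fun t : ℝ => f (t • θ)) r| ≤ M1 ∧
      |deriv (deriv (fun t : ℝ => f (t • θ))) r| ≤ M2 := by
  have hd : Differentiable ℝ f := hf.differentiable (by simp)
  have hf1 : ContDiff ℝ 1 (fderiv ℝ f) := hf.fderiv_right (m := 1) (by norm_cast)
  have hd2 : Differentiable ℝ (fderiv ℝ f) := hf1.differentiable one_ne_zero
  have b1 := bound_fderiv_aux (hf.of_le (by norm_cast)) hfc
  have b2 := bound_fderiv_aux hf1 (hfc.fderiv ℝ)
  obtain ⟨M1, g1, h1⟩ := b1
  obtain ⟨M2, g2, h2⟩ := b2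
  refine ⟨M1, M2, g1, g2, ?_⟩
  intro θ hθ r
  constructor
  · rw [(ray_deriv1 hd θ r).deriv, ← Real.norm_eq_abs]
    have := h1 (r • θ) θ
    rwa [hθ, mul_one] at this
  · rw [ray_deriv2 hd hd2 θ r, ← Real.norm_eq_abs]
    have h3 := h2 (r • θ) θ
    have h4 := (fderiv ℝ (fderiv ℝ f) (r • θ) θ).le_opNorm θ
    rw [hθ, mul_one] at h3 h4
    exact h4.trans h3

/-- Euclidean case of the weighted Rellich inequality (Theorem 4.3). -/
theorem rellich_radial (n : ℕ) (hn : 3 ≤ n) (p β : ℝ) (hp1 : 1 < p) (hpn : p < n / 2)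
    (hβl : -(n * (p - 1)) < β) (hβu : β < n - 2 * p)
    (f : EuclideanSpace ℝ (Fin n) → ℝ) (hf : ContDiff ℝ (⊤ : ℕ∞) f) (hfc : HasCompactSupport f) :
    ∫ x : EuclideanSpace ℝ (Fin n), |radLap f x| ^ p / ‖x‖ ^ β ≥
      ((n * (p - 1) + β) * (n - 2 * p - β) / p ^ 2) ^ p *
        ∫ x : EuclideanSpace ℝ (Fin n), |f x| ^ p / ‖x‖ ^ (2 * p + β) := by
  have hp0 : 0 < p := by linarith
  have hnR : (3 : ℝ) ≤ n := by exact_mod_cast hn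
  haveI : Nonempty (Fin n) := ⟨⟨0, by omega⟩⟩
  have hdim : Module.finrank ℝ (EuclideanSpace ℝ (Fin n)) = n := by simp
  have hd : Differentiable ℝ f := hf.differentiable (by simp)
  obtain ⟨M1, M2, hM1, hM2, hB⟩ := bounds_ray hf hfc
  obtain ⟨M0, hM0⟩ := hfc.exists_bound_of_continuous hf.continuous
  obtain ⟨R, hR, hRs⟩ : ∃ R : ℝ, 0 < R ∧ ∀ x, R ≤ ‖x‖ → x ∉ tsupport f := by
    obtain ⟨R, hR⟩ := hfc.isCompact.isBounded.subset_ball 0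
    refine ⟨max R 1, by positivity, fun r hr h => ?_⟩
    have := hR h
    simp only [Metric.mem_ball, dist_zero_right] at this
    have := le_max_left R 1
    linarith
  have hf0 : ∀ x, R ≤ ‖x‖ → f x = 0 := fun x hx => image_eq_zero_of_notMem_tsupport (hRs x hx)
  have hlap0 : ∀ x, R ≤ ‖x‖ → radLap f x = 0 := by
    intro x hx
    have h1 : f =ᶠ[nhds x] fun _ => 0 := notMem_tsupport_iff_eventuallyEq.1 (hRs x hx)
    have h2 : radDeriv f =ᶠ[nhds x] fun _ => 0 := by
      filter_upwards [h1.fderiv (𝕜 := ℝ)] with y hy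
      simp [radDeriv, hy]
    have h3 : radDeriv (radDeriv f) x = 0 := by
      rw [radDeriv, h2.fderiv_eq]; simp
    rw [radLap, h3, h2.eq_of_nhds]; simp
  have hlapm := measurable_radLap f
  have hfm : Measurable f := hf.continuous.measurable

  have J1 : Integrable (fun x : EuclideanSpace ℝ (Fin n) => |radLap f x| ^ p / ‖x‖ ^ β) := by
    refine integE_aux volume (by omega) hdim (K := (M2 * R + ((n : ℝ) - 1) * M1) ^ p)
      (q := -p - β) (R := R) (by fun_prop) (by linarith) hR ?_ ?_
    · intro x hx hxR
      have h0 : 0 < ‖x‖ := norm_pos_iff.2 hx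
      have hn1 : 0 ≤ (n : ℝ) - 1 := by linarith
      have hl : |radLap f x| ≤ (M2 * R + ((n : ℝ) - 1) * M1) / ‖x‖ := by
        have hθ : ‖‖x‖⁻¹ • x‖ = 1 := by rw [norm_smul, norm_inv, norm_norm]; field_simp
        have := radLap_ray hf hθ h0
        rw [smul_smul, mul_inv_cancel₀ h0.ne', one_smul] at this
        obtain ⟨b1, b2⟩ := hB _ hθ ‖x‖
        rw [this]
        generalize deriv (deriv fun t : ℝ => f (t • ‖x‖⁻¹ • x)) ‖x‖ = A at *
        generalize deriv (fun t : ℝ => f (t • ‖x‖⁻¹ • x)) ‖x‖ = B at *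
        rw [le_div_iff₀ h0]
        calc _ = |(A + ((n : ℝ) - 1) / ‖x‖ * B) * ‖x‖| := by rw [abs_mul, abs_norm]
          _ = |A * ‖x‖ + ((n : ℝ) - 1) * B| := by congr 1; field_simp
          _ ≤ |A| * ‖x‖ + ((n : ℝ) - 1) * |B| := by
            refine (abs_add_le _ _).trans ?_
            rw [abs_mul, abs_mul, abs_norm, abs_of_nonneg hn1]
          _ ≤ _ := by gcongr
      rw [abs_of_nonneg (by positivity), Real.rpow_sub h0, Real.rpow_neg h0.le, ← mul_div_assoc]
      gcongr
      calc _ ≤ ((M2 * R + ((n : ℝ) - 1) * M1) / ‖x‖) ^ p := by gcongr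
        _ = _ := by rw [Real.div_rpow (by positivity) h0.le]; rfl
    · intro x hx
      simp [hlap0 x hx, hp0.ne']
  have J0 : Integrable (fun x : EuclideanSpace ℝ (Fin n) => |f x| ^ p / ‖x‖ ^ (2 * p + β)) := by
    refine integE_aux volume (by omega) hdim (K := M0 ^ p)
      (q := -(2 * p + β)) (R := R) (by fun_prop) (by linarith) hR ?_ ?_
    · intro x hx hxR
      have h0 : 0 < ‖x‖ := norm_pos_iff.2 hx
      rw [abs_of_nonneg (by positivity), Real.rpow_neg h0.le, ← div_eq_mul_inv]
      gcongr
      exact hM0 x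
    · intro x hx
      simp [hf0 x hx, hp0.ne']
  obtain ⟨P1, Q1⟩ := polar_aux volume hdim J1
  obtain ⟨P0, Q0⟩ := polar_aux volume hdim J0
  rw [Q1, Q0, ← integral_const_mul, ge_iff_le]
  refine integral_mono (P0.const_mul _) P1 ?_
  intro θ
  have hθ : ‖θ.1‖ = 1 := by simpa using θ.2
  set φ : ℝ → ℝ := fun t => f (t • θ.1) with hφ
  have hφs : ContDiff ℝ (⊤ : ℕ∞) φ := hf.comp (contDiff_id.smul contDiff_const)
  have hφc : HasCompactSupport φ := by
    refine HasCompactSupport.intro (isCompact_closedBall (0:ℝ) R) fun t ht => ?_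
    apply hf0
    rw [norm_smul, hθ, mul_one]
    simp only [Metric.mem_closedBall, dist_zero_right, not_le] at ht
    exact ht.le
  have hφ1 : ContDiff ℝ 1 φ := hφs.of_le (by norm_cast)
  have hφ2 : ContDiff ℝ 1 (deriv φ) := by
    have : ContDiff ℝ 2 φ := hφs.of_le (by norm_cast)
    exact ((contDiff_succ_iff_deriv (n := 1)).1 (by simpa [one_add_one_eq_two] using this)).2.2
  have E1 : ∫ r in Set.Ioi (0:ℝ), r ^ (n - 1) * (|radLap f (r • θ.1)| ^ p / ‖r • θ.1‖ ^ β)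
      = ∫ r in Set.Ioi (0:ℝ), |deriv (deriv φ) r + ((n : ℝ) - 1) / r * deriv φ r| ^ p *
        r ^ ((n : ℝ) - 1 - β) := by
    refine setIntegral_congr_fun measurableSet_Ioi fun r (hr : 0 < r) => ?_
    rw [radLap_ray hf hθ hr, norm_smul, hθ, mul_one, Real.norm_eq_abs, abs_of_pos hr,
      Real.rpow_sub hr, ← Real.rpow_natCast, Nat.cast_sub (by omega), Nat.cast_one]
    ring
  have E0 : ∫ r in Set.Ioi (0:ℝ), r ^ (n - 1) * (|f (r • θ.1)| ^ p / ‖r • θ.1‖ ^ (2 * p + β))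
      = ∫ r in Set.Ioi (0:ℝ), |φ r| ^ p * r ^ ((n : ℝ) - 1 - β - p - p) := by
    refine setIntegral_congr_fun measurableSet_Ioi fun r (hr : 0 < r) => ?_
    rw [norm_smul, hθ, mul_one, Real.norm_eq_abs, abs_of_pos hr,
      show (n : ℝ) - 1 - β - p - p = ((n : ℝ) - 1) - (2 * p + β) by ring,
      Real.rpow_sub hr, ← Real.rpow_natCast, Nat.cast_sub (by omega), Nat.cast_one]
    ring
  simp only
  rw [E1, E0]
  have H1 := hardy_aux (b := (n : ℝ) - 1 - β) (k := (n : ℝ) - 1) (s := (n * (p - 1) + β) / p)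
    hp1 (by linarith) (by
      rw [abs_of_nonpos (by linarith)]; congr 1; ring) hφ2 hφc.deriv
  have H0 := hardy_aux (b := (n : ℝ) - 1 - β - p) (k := 0) (s := (n - 2 * p - β) / p)
    hp1 (by linarith) (by
      rw [abs_of_nonneg (by linarith)]; congr 1; ring) hφ1 hφc
  simp only [zero_div, zero_mul, add_zero] at H0
  have c1 : 0 ≤ (n * (p - 1) + β) / p := div_nonneg (by linarith) hp0.le
  have c2 : 0 ≤ (n - 2 * p - β) / p := div_nonneg (by linarith) hp0.le
  have ec : (n * (p - 1) + β) * (n - 2 * p - β) / p ^ 2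
      = ((n * (p - 1) + β) / p) * ((n - 2 * p - β) / p) := by field_simp
  rw [ec, Real.mul_rpow c1 c2, mul_assoc]
  exact (mul_le_mul_of_nonneg_left H0 (Real.rpow_nonneg c1 p)).trans H1
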